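/- The function F satisfies the functional equation F(x/2) + F((x+1)/2) = F(x) + 1/2 for all x ∈ [0,1]. -/

import Mathlib

open Real MeasureTheory Filter Topology

noncomputable section

/-- The Thue–Morse correlation coefficients: `η 0 = 1`, `η 1 = -1/3`,
and for `m ≥ 1`, `η (2m) = η m` and `η (2m+1) = -(η m + η (m+1))/2`. -/
def eta : ℕ → ℝ
  | 0 => 1
  | 1 => -(1 / 3)
  | n + 2 =>
    if (n + 2) % 2 = 0 then eta ((n + 2) / 2)
    else -(eta ((n + 2) / 2) + eta ((n + 2) / 2 + 1)) / 2
  decreasing_by all_goals omega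

/-- The Thue–Morse distribution function
`F(x) = x + ∑_{m≥1} (η(m)/(mπ))·sin(2πmx)`. -/
def F (x : ℝ) : ℝ :=
  x + ∑' m : ℕ, eta (m + 1) / ((m + 1 : ℝ) * π) * Real.sin (2 * π * (m + 1) * x)

theorem eta_one : eta 1 = -(1 / 3) := by
  simp [eta]

theorem eta_two_mul {m : ℕ} (hm : 1 ≤ m) : eta (2 * m) = eta m := by
  obtain ⟨k, rfl⟩ := Nat.exists_eq_add_of_le' hm
  rw [show 2 * (k + 1) = 2 * k + 2 by ring, eta, if_pos (by omega)]
  congr 1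
  omega

theorem eta_two_mul_add_one {m : ℕ} (hm : 1 ≤ m) :
    eta (2 * m + 1) = -(eta m + eta (m + 1)) / 2 := by
  obtain ⟨k, rfl⟩ := Nat.exists_eq_add_of_le' hm
  rw [show 2 * (k + 1) + 1 = (2 * k + 1) + 2 by ring, eta, if_neg (by omega),
    show (2 * k + 1 + 2) / 2 = k + 1 by omega]

theorem eta_two_pow (k : ℕ) : eta (2 ^ k) = -(1 / 3) := by
  induction k with
  | zero => simpa using eta_one
  | succ k ih => rw [pow_succ', eta_two_mul Nat.one_le_two_pow, ih]

theorem sum_Ico_two_mul (f : ℕ → ℝ) {a b : ℕ} (hab : a ≤ b) :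
    ∑ m ∈ Finset.Ico (2 * a) (2 * b), f m =
      ∑ m ∈ Finset.Ico a b, (f (2 * m) + f (2 * m + 1)) := by
  induction b, hab using Nat.le_induction with
  | base => simp
  | succ b hb ih =>
    rw [Finset.sum_Ico_succ_top hb, ← ih, show 2 * (b + 1) = 2 * b + 1 + 1 by ring,
      Finset.sum_Ico_succ_top (by omega), Finset.sum_Ico_succ_top (by omega)]
    ring

theorem sum_Ico_shift (f : ℕ → ℝ) {a b : ℕ} (hab : a ≤ b) :
    ∑ m ∈ Finset.Ico a b, f (m + 1) = ∑ m ∈ Finset.Ico a b, f m + f b - f a := by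
  induction b, hab using Nat.le_induction with
  | base => simp
  | succ b hb ih =>
    rw [Finset.sum_Ico_succ_top hb, Finset.sum_Ico_succ_top hb, ih]
    ring

/-- The sum of `η(m)²` over the dyadic block `2^k ≤ m < 2^(k+1)`. -/
def etaSqBlock (k : ℕ) : ℝ :=
  ∑ m ∈ Finset.Ico (2 ^ k) (2 ^ (k + 1)), eta m ^ 2

/-- The sum of `η(m) η(m+1)` over the dyadic block `2^k ≤ m < 2^(k+1)`. -/
def etaCorrBlock (k : ℕ) : ℝ :=
  ∑ m ∈ Finset.Ico (2 ^ k) (2 ^ (k + 1)), eta m * eta (m + 1)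

theorem two_pow_le_two_pow_succ (k : ℕ) : 2 ^ k ≤ 2 ^ (k + 1) :=
  Nat.pow_le_pow_right (by norm_num) (Nat.le_succ k)

theorem sum_eta_succ_sq (k : ℕ) :
    ∑ m ∈ Finset.Ico (2 ^ k) (2 ^ (k + 1)), eta (m + 1) ^ 2 = etaSqBlock k := by
  rw [sum_Ico_shift (fun m => eta m ^ 2) (two_pow_le_two_pow_succ k), eta_two_pow,
    eta_two_pow, etaSqBlock]
  ring

theorem etaSqBlock_succ (k : ℕ) :
    etaSqBlock (k + 1) = 3 / 2 * etaSqBlock k + 1 / 2 * etaCorrBlock k := by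
  have h : etaSqBlock (k + 1) = ∑ m ∈ Finset.Ico (2 ^ k) (2 ^ (k + 1)),
      (5 / 4 * eta m ^ 2 + 1 / 4 * eta (m + 1) ^ 2 + 1 / 2 * (eta m * eta (m + 1))) := by
    rw [etaSqBlock, pow_succ' 2 (k + 1), pow_succ' 2 k,
      sum_Ico_two_mul _ (by have := two_pow_le_two_pow_succ k; omega)]
    refine Finset.sum_congr rfl fun m hm => ?_
    have hm1 : 1 ≤ m := Nat.one_le_two_pow.trans (Finset.mem_Ico.1 hm).1
    rw [eta_two_mul hm1, eta_two_mul_add_one hm1]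
    ring
  rw [h, Finset.sum_add_distrib, Finset.sum_add_distrib, ← Finset.mul_sum, ← Finset.mul_sum,
    ← Finset.mul_sum, sum_eta_succ_sq, ← etaSqBlock, ← etaCorrBlock]
  ring

theorem sum_eta_add_sq (k : ℕ) :
    ∑ m ∈ Finset.Ico (2 ^ k) (2 ^ (k + 1)), (eta m + eta (m + 1)) ^ 2 =
      2 * (etaSqBlock k + etaCorrBlock k) := by
  have h : ∑ m ∈ Finset.Ico (2 ^ k) (2 ^ (k + 1)), (eta m + eta (m + 1)) ^ 2 =
      ∑ m ∈ Finset.Ico (2 ^ k) (2 ^ (k + 1)),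
        (eta m ^ 2 + eta (m + 1) ^ 2 + 2 * (eta m * eta (m + 1))) :=
    Finset.sum_congr rfl fun m _ => by ring
  rw [h, Finset.sum_add_distrib, Finset.sum_add_distrib, ← Finset.mul_sum, sum_eta_succ_sq,
    ← etaSqBlock, ← etaCorrBlock]
  ring

theorem etaCorrBlock_succ (k : ℕ) :
    etaCorrBlock (k + 1) = -(etaSqBlock k + etaCorrBlock k) := by
  have h : etaCorrBlock (k + 1) = ∑ m ∈ Finset.Ico (2 ^ k) (2 ^ (k + 1)),
      -(1 / 2) * (eta m + eta (m + 1)) ^ 2 := by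
    rw [etaCorrBlock, pow_succ' 2 (k + 1), pow_succ' 2 k,
      sum_Ico_two_mul _ (by have := two_pow_le_two_pow_succ k; omega)]
    refine Finset.sum_congr rfl fun m hm => ?_
    have hm1 : 1 ≤ m := Nat.one_le_two_pow.trans (Finset.mem_Ico.1 hm).1
    rw [show 2 * m + 1 + 1 = 2 * (m + 1) by ring, eta_two_mul hm1,
      eta_two_mul (Nat.le_add_left 1 m), eta_two_mul_add_one hm1]
    ring
  rw [h, ← Finset.mul_sum, sum_eta_add_sq]
  ring

theorem etaSqBlock_add_etaCorrBlock_nonneg (k : ℕ) : 0 ≤ etaSqBlock k + etaCorrBlock k := by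
  have h : 0 ≤ ∑ m ∈ Finset.Ico (2 ^ k) (2 ^ (k + 1)), (eta m + eta (m + 1)) ^ 2 :=
    Finset.sum_nonneg fun m _ => sq_nonneg _
  rw [sum_eta_add_sq] at h
  linarith

/-- The block sums of `η²` grow at rate at most `4/3`, seen from the quantity
`etaSqBlock k + etaCorrBlock k / 4`, which grows by a factor of at most `4/3` per step. -/
theorem etaSqBlock_le (k : ℕ) : etaSqBlock k ≤ (4 / 3) ^ k := by
  have h : etaSqBlock k + etaCorrBlock k / 4 ≤ 3 / 4 * (4 / 3) ^ k := by
    induction k with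
    | zero =>
      have h2 : eta 2 = -(1 / 3) := by simpa using eta_two_pow 1
      norm_num [etaSqBlock, etaCorrBlock, eta_one, h2]
    | succ k ih =>
      have := etaSqBlock_add_etaCorrBlock_nonneg k
      rw [etaSqBlock_succ, etaCorrBlock_succ, pow_succ]
      linarith
  have := etaSqBlock_add_etaCorrBlock_nonneg k
  linarith

theorem sum_abs_eta_div_block_le (k : ℕ) :
    ∑ m ∈ Finset.Ico (2 ^ k) (2 ^ (k + 1)), |eta m| / m ≤
      (4 / 5 : ℝ) ^ k + (5 / 6 : ℝ) ^ k := by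
  have h : ∀ m ∈ Finset.Ico (2 ^ k) (2 ^ (k + 1)),
      |eta m| / m ≤ (3 / 5 : ℝ) ^ k * eta m ^ 2 + (5 / 12 : ℝ) ^ k := by
    intro m hm
    have hm2 : (2 : ℝ) ^ k ≤ m := by exact_mod_cast (Finset.mem_Ico.1 hm).1
    have hp : (0 : ℝ) < (6 / 5) ^ k := by positivity
    have hq : (6 / 5 : ℝ) ^ k * (5 / 6) ^ k = 1 := by rw [← mul_pow]; norm_num
    have hq0 : (0 : ℝ) < (5 / 6) ^ k := by positivity
    have amgm : |eta m| ≤ (6 / 5 : ℝ) ^ k * eta m ^ 2 + (5 / 6) ^ k := by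
      rw [← sq_abs]
      have h1 : (6 / 5 : ℝ) ^ k * (|eta m| - (5 / 6) ^ k) ^ 2 =
          (6 / 5 : ℝ) ^ k * |eta m| ^ 2 - 2 * |eta m| + (5 / 6) ^ k := by
        linear_combination ((5 / 6 : ℝ) ^ k - 2 * |eta m|) * hq
      have h2 : 0 ≤ (6 / 5 : ℝ) ^ k * (|eta m| - (5 / 6) ^ k) ^ 2 := by positivity
      linarith [abs_nonneg (eta m)]
    calc |eta m| / m ≤ |eta m| / 2 ^ k := by gcongr
      _ ≤ ((6 / 5 : ℝ) ^ k * eta m ^ 2 + (5 / 6) ^ k) / 2 ^ k := by gcongr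
      _ = (6 / 5 / 2 : ℝ) ^ k * eta m ^ 2 + (5 / 6 / 2) ^ k := by
        rw [div_pow (6 / 5 : ℝ), div_pow (5 / 6 : ℝ)]; ring
      _ = _ := by norm_num
  have hcard : (Finset.Ico (2 ^ k) (2 ^ (k + 1))).card = 2 ^ k := by
    rw [Nat.card_Ico, pow_succ]; omega
  calc _ ≤ _ := Finset.sum_le_sum h
    _ = (3 / 5 : ℝ) ^ k * etaSqBlock k + 2 ^ k * (5 / 12 : ℝ) ^ k := by
      rw [Finset.sum_add_distrib, ← Finset.mul_sum, Finset.sum_const, hcard, nsmul_eq_mul,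
        etaSqBlock]
      norm_num
    _ ≤ (3 / 5 : ℝ) ^ k * (4 / 3) ^ k + 2 ^ k * (5 / 12 : ℝ) ^ k := by
      gcongr
      exact etaSqBlock_le k
    _ = _ := by rw [← mul_pow, ← mul_pow]; norm_num

theorem summable_abs_eta_div : Summable fun m : ℕ => |eta (m + 1)| / ((m : ℝ) + 1) := by
  have hs : Summable fun k : ℕ => (4 / 5 : ℝ) ^ k + (5 / 6 : ℝ) ^ k :=
    (summable_geometric_of_lt_one (by norm_num) (by norm_num)).add
      (summable_geometric_of_lt_one (by norm_num) (by norm_num))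
  have hblocks : ∀ n : ℕ, ∑ m ∈ Finset.Ico 1 (2 ^ n), |eta m| / m ≤
      ∑ k ∈ Finset.range n, ((4 / 5 : ℝ) ^ k + (5 / 6 : ℝ) ^ k) := by
    intro n
    induction n with
    | zero => simp
    | succ n ih =>
      rw [← Finset.sum_Ico_consecutive _ Nat.one_le_two_pow (two_pow_le_two_pow_succ n),
        Finset.sum_range_succ]
      exact add_le_add ih (sum_abs_eta_div_block_le n)
  refine summable_of_sum_range_le (c := ∑' k : ℕ, ((4 / 5 : ℝ) ^ k + (5 / 6 : ℝ) ^ k))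
    (fun m => by positivity) fun n => ?_
  calc ∑ m ∈ Finset.range n, |eta (m + 1)| / ((m : ℝ) + 1)
      = ∑ m ∈ Finset.Ico 1 (n + 1), |eta m| / m := by
        rw [Finset.sum_Ico_eq_sum_range]
        simp [add_comm]
    _ ≤ ∑ m ∈ Finset.Ico 1 (2 ^ n), |eta m| / m :=
        Finset.sum_le_sum_of_subset_of_nonneg
          (Finset.Ico_subset_Ico le_rfl Nat.lt_two_pow_self) fun m _ _ => by positivity
    _ ≤ _ := hblocks n
    _ ≤ _ := hs.sum_le_tsum _ fun k _ => by positivity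

theorem summable_F_series (x : ℝ) :
    Summable fun m : ℕ =>
      eta (m + 1) / ((m + 1 : ℝ) * π) * Real.sin (2 * π * (m + 1) * x) := by
  refine Summable.of_norm_bounded (summable_abs_eta_div.mul_right (1 / π)) fun m => ?_
  have hm : (0 : ℝ) < (m : ℝ) + 1 := by positivity
  rw [Real.norm_eq_abs, abs_mul, abs_div, abs_of_pos (mul_pos hm Real.pi_pos),
    div_mul_div_comm, mul_one]
  exact mul_le_of_le_one_right (by positivity) (Real.abs_sin_le_one _)

/-- `F(x/2) + F((x+1)/2) = F(x) + 1/2` for all `x ∈ [0,1]`. -/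
theorem F_functional_equation :
    ∀ x ∈ Set.Icc (0 : ℝ) 1, F (x / 2) + F ((x + 1) / 2) = F x + 1 / 2 := by
  intro x _
  have hadd := (summable_F_series (x / 2)).tsum_add (summable_F_series ((x + 1) / 2))
  have hshift (n : ℕ) : Real.sin (2 * π * (n + 1) * ((x + 1) / 2)) =
      (-1) ^ (n + 1) * Real.sin (2 * π * (n + 1) * (x / 2)) := by
    rw [← Real.sin_add_nat_mul_pi]
    congr 1
    push_cast
    ring
  have hinj : Function.Injective fun j : ℕ => 2 * j + 1 := fun a b h => by
    simp only at h
    omega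
  have hfold := hinj.tsum_eq (f := fun m : ℕ =>
      eta (m + 1) / ((m + 1 : ℝ) * π) * Real.sin (2 * π * (m + 1) * (x / 2)) +
      eta (m + 1) / ((m + 1 : ℝ) * π) * Real.sin (2 * π * (m + 1) * ((x + 1) / 2))) (by
    intro m hm
    rcases Nat.even_or_odd m with he | ⟨j, rfl⟩
    · refine absurd ?_ hm
      simp only [hshift, he.add_one.neg_one_pow]
      ring
    · exact ⟨j, rfl⟩)
  have hterm (j : ℕ) :
      eta (2 * j + 1 + 1) / (((2 * j + 1 : ℕ) + 1 : ℝ) * π) *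
          Real.sin (2 * π * ((2 * j + 1 : ℕ) + 1) * (x / 2)) +
        eta (2 * j + 1 + 1) / (((2 * j + 1 : ℕ) + 1 : ℝ) * π) *
          Real.sin (2 * π * ((2 * j + 1 : ℕ) + 1) * ((x + 1) / 2)) =
      eta (j + 1) / ((j + 1 : ℝ) * π) * Real.sin (2 * π * (j + 1) * x) := by
    have heven : Even (2 * j + 1 + 1) := ⟨j + 1, by ring⟩
    have hj : (j : ℝ) + 1 ≠ 0 := by positivity
    have hcast : ((2 * j + 1 : ℕ) : ℝ) + 1 = 2 * (j + 1) := by push_cast; ring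
    rw [hshift, heven.neg_one_pow, show 2 * j + 1 + 1 = 2 * (j + 1) by ring,
      eta_two_mul (Nat.le_add_left 1 j), hcast,
      show 2 * π * (2 * ((j : ℝ) + 1)) * (x / 2) = 2 * π * (j + 1) * x by ring]
    field_simp
    ring
  rw [← hfold, tsum_congr hterm] at hadd
  simp only [F]
  linarith
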